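/- The second basic cohomology of the Schrödinger-Virasoro conformal algebra with trivial coefficients vanishes: H̃²(SV,ℂ) = 0, i.e., every 2-cocycle is a 2-coboundary. -/

import Mathlib

/-!
Cochain complex of the Schrödinger–Virasoro conformal algebra
`SV = ℂ[∂]L ⊕ ℂ[∂]Y ⊕ ℂ[∂]M` with coefficients in the trivial module `ℂ_a`.

Since `SV` is a free `ℂ[∂]`-module on the generators `L, Y, M`, and since a
`q`-cochain (a `ℂ`-linear, conformally antilinear map `SV^{⊗q} → ℂ[λ₁,…,λ_q]`)
is uniquely determined by its values on `q`-tuples of generators, we model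
cochains as functions from generator tuples to `ℂ[λ₁,…,λ_q]`, subject to the
skew-symmetry condition (simultaneous permutation of the entries and the
variables `λᵢ`).
-/

namespace SVCA

open MvPolynomial

/-- The generators `L`, `Y`, `M` of the Schrödinger–Virasoro conformal algebra. -/
inductive SVGen : Type
  | L | Y | M
  deriving DecidableEq

open SVGen

/-- The λ-brackets on generators: `SVbrk a b = (x, c₁, c₂)` encodes
`[a_λ b] = (c₁ ∂ + c₂ λ) x`.  Zero brackets are encoded by zero coefficients:
`[L_λ L] = (∂+2λ)L`, `[L_λ Y] = (∂+(3/2)λ)Y`, `[Y_λ L] = ((1/2)∂+(3/2)λ)Y`,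
`[Y_λ Y] = (∂+2λ)M`, `[L_λ M] = (∂+λ)M`, `[M_λ L] = λM`, and
`[Y_λ M] = [M_λ Y] = [M_λ M] = 0`. -/
noncomputable def SVbrk : SVGen → SVGen → SVGen × ℂ × ℂ
  | L, L => (L, 1, 2)
  | L, Y => (Y, 1, 3/2)
  | Y, L => (Y, 1/2, 3/2)
  | Y, Y => (M, 1, 2)
  | L, M => (M, 1, 1)
  | M, L => (M, 0, 1)
  | _, _ => (M, 0, 0)

/-- The space of (not necessarily skew-symmetric) `q`-cochains with trivial
coefficients: functions from `q`-tuples of generators to `ℂ[λ₁,…,λ_q]`. -/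
abbrev SVRaw (q : ℕ) := (Fin q → SVGen) → MvPolynomial (Fin q) ℂ

/-- The `ℂ`-subspace `C̃^q(SV,ℂ)` of `q`-cochains: skew-symmetry with respect to
simultaneous permutations of the arguments and of the variables `λᵢ`. -/
noncomputable def SVCochain (q : ℕ) : Submodule ℂ (SVRaw q) where
  carrier := {c | ∀ (σ : Equiv.Perm (Fin q)) (a : Fin q → SVGen),
      rename σ (c (a ∘ σ)) = ((Equiv.Perm.sign σ : ℤ) : ℂ) • c a}
  add_mem' := by
    intro c c' hc hc' σ a
    simp only [Pi.add_apply, map_add, hc σ a, hc' σ a, smul_add]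
  zero_mem' := by intro σ a; simp
  smul_mem' := by
    intro r c hc σ a
    simp only [Pi.smul_apply, map_smul, hc σ a]
    rw [smul_comm]

/-- The strictly increasing embedding `Fin q → Fin (q+2)` omitting `i` and `j`
(meaningful for `i < j`; junk otherwise). -/
def SVskip {q : ℕ} (i j : Fin (q + 2)) (k : Fin q) : Fin (q + 2) :=
  j.succAbove ((⟨min (i : ℕ) q, Nat.lt_succ_of_le (Nat.min_le_right _ _)⟩ : Fin (q + 1)).succAbove k)

/-- The `(i,j)`-summand of the differential (trivial coefficients):
`(-1)^{i+j} γ_{λᵢ+λⱼ, λ₁, …, λ̂ᵢ, …, λ̂ⱼ, …}([a_{i λᵢ} a_j], a₁, …, âᵢ, …, âⱼ, …)`,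
where `[a_{i λᵢ} a_j] = (c₁∂ + c₂λᵢ)x` and conformal antilinearity in the first
slot (whose variable is `λᵢ+λⱼ`) produces the factor `c₂λᵢ - c₁(λᵢ+λⱼ)`. -/
noncomputable def SVdTerm {q : ℕ} (c : SVRaw (q + 1)) (a : Fin (q + 2) → SVGen)
    (i j : Fin (q + 2)) : MvPolynomial (Fin (q + 2)) ℂ :=
  ((-1 : ℂ) ^ ((i : ℕ) + (j : ℕ))) •
    ((C (SVbrk (a i) (a j)).2.2 * X i - C (SVbrk (a i) (a j)).2.1 * (X i + X j)) *
      aeval (Fin.cons (X i + X j) fun k => X (SVskip i j k))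
        (c (Fin.cons (SVbrk (a i) (a j)).1 fun k => a (SVskip i j k))))

/-- The differential `d_q : C̃^q → C̃^{q+1}` (trivial coefficients). -/
noncomputable def SVd : {q : ℕ} → SVRaw q → SVRaw (q + 1)
  | 0, _ => 0
  | (q + 1), c => fun a =>
      ∑ i : Fin (q + 2), ∑ j : Fin (q + 2),
        if (i : ℕ) < (j : ℕ) then SVdTerm c a i j else 0

lemma SVdTerm_add {q : ℕ} (c c' : SVRaw (q + 1)) (a : Fin (q + 2) → SVGen)
    (i j : Fin (q + 2)) :
    SVdTerm (c + c') a i j = SVdTerm c a i j + SVdTerm c' a i j := by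
  simp [SVdTerm, mul_add, smul_add]

lemma SVdTerm_smul {q : ℕ} (r : ℂ) (c : SVRaw (q + 1)) (a : Fin (q + 2) → SVGen)
    (i j : Fin (q + 2)) :
    SVdTerm (r • c) a i j = r • SVdTerm c a i j := by
  simp only [SVdTerm, Pi.smul_apply, map_smul, mul_smul_comm]
  rw [smul_comm]

/-- The differential as a `ℂ`-linear map. -/
noncomputable def SVdLin (q : ℕ) : SVRaw q →ₗ[ℂ] SVRaw (q + 1) where
  toFun := SVd
  map_add' c c' := by
    cases q with
    | zero => simp [SVd]
    | succ q =>
      funext a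
      simp only [SVd, Pi.add_apply]
      rw [← Finset.sum_add_distrib]
      refine Finset.sum_congr rfl fun i _ => ?_
      rw [← Finset.sum_add_distrib]
      refine Finset.sum_congr rfl fun j _ => ?_
      by_cases h : (i : ℕ) < (j : ℕ)
      · simp [h, SVdTerm_add]
      · simp [h]
  map_smul' r c := by
    cases q with
    | zero => simp [SVd]
    | succ q =>
      funext a
      simp only [SVd, RingHom.id_apply, Pi.smul_apply, Finset.smul_sum]
      refine Finset.sum_congr rfl fun i _ => ?_
      refine Finset.sum_congr rfl fun j _ => ?_
      by_cases h : (i : ℕ) < (j : ℕ)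
      · simp [h, SVdTerm_smul]
      · simp [h]

/-- The space `D̃^q(SV,ℂ)` of `q`-cocycles: skew-symmetric cochains with `dγ = 0`. -/
noncomputable def SVcocycles (q : ℕ) : Submodule ℂ (SVRaw q) :=
  SVCochain q ⊓ LinearMap.ker (SVdLin q)

/-- The space `B̃^q(SV,ℂ)` of `q`-coboundaries: differentials of `(q-1)`-cochains
(`0` for `q = 0`). -/
noncomputable def SVcoboundaries : (q : ℕ) → Submodule ℂ (SVRaw q)
  | 0 => ⊥
  | (q + 1) => Submodule.map (SVdLin q) (SVCochain q)

/-- The basic cohomology `H̃^q(SV,ℂ)` = cocycles / coboundaries. -/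
noncomputable def SVbasicH (q : ℕ) :=
  SVcocycles q ⧸ Submodule.comap (SVcocycles q).subtype (SVcoboundaries q)


noncomputable instance (q : ℕ) : AddCommGroup (SVbasicH q) := by
  unfold SVbasicH; infer_instance
noncomputable instance (q : ℕ) : Module ℂ (SVbasicH q) := by
  unfold SVbasicH; infer_instance

/-- The action of `∂` on `q`-cochains with coefficients in `ℂ_a`:
`(∂γ)_{λ₁,…,λ_q} = (a + λ₁ + ⋯ + λ_q)·γ_{λ₁,…,λ_q}`.  (The trivial module `ℂ`
is the case `a = 0`.) -/
noncomputable def SVpartial (a : ℂ) (q : ℕ) : SVRaw q →ₗ[ℂ] SVRaw q where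
  toFun c := fun t => (C a + ∑ i, X i) * c t
  map_add' c c' := by funext t; simp [mul_add]
  map_smul' r c := by funext t; simp [mul_smul_comm]

/-- The subspace `∂C̃^q ⊆ C̃^q` (with coefficients in `ℂ_a`). -/
noncomputable def SVpartialSub (a : ℂ) (q : ℕ) : Submodule ℂ (SVRaw q) :=
  Submodule.map (SVpartial a q) (SVCochain q)

/-- `q`-cochains representing reduced `q`-cocycles: cochains `γ` with
`dγ ∈ ∂C̃^{q+1}` (these are exactly the representatives of `ker d̄`
in the quotient complex `C̃^•/∂C̃^•`). -/
noncomputable def SVredCocycles (a : ℂ) (q : ℕ) : Submodule ℂ (SVRaw q) :=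
  SVCochain q ⊓ Submodule.comap (SVdLin q) (SVpartialSub a (q + 1))

/-- `q`-cochains representing reduced `q`-coboundaries: `∂C̃^q + dC̃^{q-1}`
(these are exactly the representatives of `im d̄` in the quotient complex). -/
noncomputable def SVredCoboundaries (a : ℂ) : (q : ℕ) → Submodule ℂ (SVRaw q)
  | 0 => SVpartialSub a 0
  | (q + 1) => SVpartialSub a (q + 1) ⊔ Submodule.map (SVdLin q) (SVCochain q)

/-- The reduced cohomology `H^q(SV,ℂ_a)`, realized (via the third isomorphism
theorem) as `{γ ∈ C̃^q : dγ ∈ ∂C̃^{q+1}} / (∂C̃^q + dC̃^{q-1})`. -/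
noncomputable def SVredH (a : ℂ) (q : ℕ) :=
  SVredCocycles a q ⧸ Submodule.comap (SVredCocycles a q).subtype (SVredCoboundaries a q)


noncomputable instance (a : ℂ) (q : ℕ) : AddCommGroup (SVredH a q) := by
  unfold SVredH; infer_instance
noncomputable instance (a : ℂ) (q : ℕ) : Module ℂ (SVredH a q) := by
  unfold SVredH; infer_instance

/-- The cocycles of the subcomplex `∂C̃^•` (trivial coefficients `ℂ`). -/
noncomputable def SVsubCocycles (q : ℕ) : Submodule ℂ (SVRaw q) :=
  SVpartialSub 0 q ⊓ LinearMap.ker (SVdLin q)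

/-- The coboundaries of the subcomplex `∂C̃^•` (trivial coefficients `ℂ`). -/
noncomputable def SVsubCoboundaries : (q : ℕ) → Submodule ℂ (SVRaw q)
  | 0 => ⊥
  | (q + 1) => Submodule.map (SVdLin q) (SVpartialSub 0 q)

/-- The cohomology `H^q(∂C̃^•)` of the subcomplex `∂C̃^•` (trivial coefficients). -/
noncomputable def SVsubH (q : ℕ) :=
  SVsubCocycles q ⧸ Submodule.comap (SVsubCocycles q).subtype (SVsubCoboundaries q)


noncomputable instance (q : ℕ) : AddCommGroup (SVsubH q) := by
  unfold SVsubH; infer_instance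
noncomputable instance (q : ℕ) : Module ℂ (SVsubH q) := by
  unfold SVsubH; infer_instance

/-- The operator `τ`:
`(τγ)_{λ₁,…,λ_{q-1}}(a₁,…,a_{q-1}) = (-1)^{q-1} ∂/∂λ γ_{λ₁,…,λ_{q-1},λ}(a₁,…,a_{q-1},L)|_{λ=0}`. -/
noncomputable def SVtau {q : ℕ} (c : SVRaw (q + 1)) : SVRaw q := fun a =>
  ((-1 : ℂ) ^ q) •
    aeval (Fin.snoc (fun i : Fin q => X i) 0)
      (pderiv (Fin.last q) (c (Fin.snoc a SVGen.L)))

/-- The operator `τ₂`: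
`(τ₂γ)_{λ₁,…,λ_{q-1}}(a₁,…,a_{q-1}) = (-1)^{q-1} γ_{λ₁,…,λ_{q-1},λ}(a₁,…,a_{q-1},L)|_{λ=0}`. -/
noncomputable def SVtau2 {q : ℕ} (c : SVRaw (q + 1)) : SVRaw q := fun a =>
  ((-1 : ℂ) ^ q) • aeval (Fin.snoc (fun i : Fin q => X i) 0) (c (Fin.snoc a SVGen.L))

/-- The tuple with `k` copies of `L`, then `l` copies of `Y`, then copies of `M`. -/
def SVtuple (q k l : ℕ) : Fin q → SVGen := fun i =>
  if (i : ℕ) < k then SVGen.L else if (i : ℕ) < k + l then SVGen.Y else SVGen.M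

/-- `∏_{i<j ∈ s} (λᵢ - λⱼ)`. -/
noncomputable def SVvandermonde (q : ℕ) (s : Finset (Fin q)) : MvPolynomial (Fin q) ℂ :=
  ∏ p ∈ (s ×ˢ s).filter fun p => p.1 < p.2, (X p.1 - X p.2)

lemma SVd_one_apply (f : SVRaw 1) (a : Fin 2 → SVGen) :
    SVd f a = -((C (SVbrk (a 0) (a 1)).2.2 * X 0 -
      C (SVbrk (a 0) (a 1)).2.1 * (X 0 + X 1)) *
        aeval ![X 0 + X 1] (f ![(SVbrk (a 0) (a 1)).1])) := by
  have h1 : (Fin.cons (X 0 + X 1) fun k : Fin 0 => X (SVskip 0 1 k) :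
      Fin 1 → MvPolynomial (Fin 2) ℂ) = ![X 0 + X 1] := by
    funext i; fin_cases i; rfl
  have h2 : (Fin.cons (SVbrk (a 0) (a 1)).1 fun k : Fin 0 => a (SVskip 0 1 k) :
      Fin 1 → SVGen) = ![(SVbrk (a 0) (a 1)).1] := by
    funext i; fin_cases i; rfl
  simp [SVd, SVdTerm, Fin.sum_univ_two, h1, h2]

lemma SVd_two_apply (c : SVRaw 2) (a : Fin 3 → SVGen) :
    SVd c a =
      -((C (SVbrk (a 0) (a 1)).2.2 * X 0 - C (SVbrk (a 0) (a 1)).2.1 * (X 0 + X 1)) *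
        aeval ![X 0 + X 1, X 2] (c ![(SVbrk (a 0) (a 1)).1, a 2])) +
      (C (SVbrk (a 0) (a 2)).2.2 * X 0 - C (SVbrk (a 0) (a 2)).2.1 * (X 0 + X 2)) *
        aeval ![X 0 + X 2, X 1] (c ![(SVbrk (a 0) (a 2)).1, a 1]) -
      (C (SVbrk (a 1) (a 2)).2.2 * X 1 - C (SVbrk (a 1) (a 2)).2.1 * (X 1 + X 2)) *
        aeval ![X 1 + X 2, X 0] (c ![(SVbrk (a 1) (a 2)).1, a 0]) := by
  have key (i j k : Fin 3) (h : SVskip (q := 1) i j 0 = k) : SVdTerm c a i j =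
      ((-1 : ℂ) ^ ((i : ℕ) + (j : ℕ))) •
        ((C (SVbrk (a i) (a j)).2.2 * X i - C (SVbrk (a i) (a j)).2.1 * (X i + X j)) *
          aeval ![X i + X j, X k] (c ![(SVbrk (a i) (a j)).1, a k])) := by
    have h1 : (Fin.cons (X i + X j) fun k => X (SVskip i j k) :
        Fin 2 → MvPolynomial (Fin 3) ℂ) = ![X i + X j, X k] := by
      funext t; fin_cases t <;> simp [h]
    have h2 : (Fin.cons (SVbrk (a i) (a j)).1 fun k => a (SVskip i j k) :
        Fin 2 → SVGen) = ![(SVbrk (a i) (a j)).1, a k] := by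
      funext t; fin_cases t <;> simp [h]
    rw [SVdTerm, h1, h2]
  change (∑ i : Fin 3, ∑ j : Fin 3, if (i : ℕ) < (j : ℕ) then SVdTerm c a i j else 0) = _
  simp only [Fin.sum_univ_three]
  norm_num only [Fin.val_zero, Fin.val_one, Fin.val_two, if_true, if_false, zero_add, add_zero]
  rw [key 0 1 2 (by decide), key 0 2 1 (by decide), key 1 2 0 (by decide)]
  norm_num [neg_smul]
  ring

lemma SVd_SVd_one (f : SVRaw 1) : SVd (SVd f) = 0 := by
  funext a
  rw [SVd_two_apply]
  simp only [SVd_one_apply, map_neg, map_mul, map_sub, map_add, aeval_X, aeval_C,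
    ← AlgHom.comp_apply, comp_aeval]
  have h (u v : MvPolynomial (Fin 3) ℂ) :
      (fun i : Fin 1 => aeval ![u, v] ((![X 0 + X 1] : Fin 1 → MvPolynomial (Fin 2) ℂ) i)) =
        ![u + v] := by
    funext i; fin_cases i; simp
  have e1 : (X 0 + X 2 + X 1 : MvPolynomial (Fin 3) ℂ) = X 0 + X 1 + X 2 := by ring
  have e2 : (X 1 + X 2 + X 0 : MvPolynomial (Fin 3) ℂ) = X 0 + X 1 + X 2 := by ring
  simp only [h, e1, e2]
  generalize a 0 = p
  generalize a 1 = q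
  generalize a 2 = r
  apply MvPolynomial.funext
  intro x
  cases p <;> cases q <;> cases r <;>
    simp [SVbrk, algebraMap_eq, -aeval_eq_bind₁] <;> ring

lemma rename_swap_SVd_one (f : SVRaw 1) (a b : SVGen) :
    rename (Equiv.swap 0 1) (SVd f ![b, a]) = -SVd f ![a, b] := by
  simp only [SVd_one_apply, map_neg, map_mul, map_sub, map_add, rename_X, rename_C]
  have h (u : MvPolynomial (Fin 1) ℂ) :
      rename (Equiv.swap 0 1) (aeval ![X 0 + X 1] u) =
        (aeval ![X 0 + X 1] u : MvPolynomial (Fin 2) ℂ) := by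
    rw [← AlgHom.comp_apply, comp_aeval]
    congr 2
    funext i
    fin_cases i
    simp [add_comm]
  simp only [h]
  apply MvPolynomial.funext
  intro x
  cases a <;> cases b <;> simp [SVbrk, -aeval_eq_bind₁] <;> ring

lemma mem_SVCochain_two_iff (c : SVRaw 2) :
    c ∈ SVCochain 2 ↔ ∀ a b, rename (Equiv.swap 0 1) (c ![b, a]) = -c ![a, b] := by
  constructor
  · intro h a b
    have := h (Equiv.swap 0 1) ![a, b]
    have e : (![a, b] ∘ Equiv.swap 0 1 : Fin 2 → SVGen) = ![b, a] := by
      funext i; fin_cases i <;> rfl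
    rw [e] at this
    simpa using this
  · intro h σ a
    have ha : a = ![a 0, a 1] := by funext i; fin_cases i <;> rfl
    have hσ : σ = 1 ∨ σ = Equiv.swap 0 1 := by
      revert σ; decide
    rcases hσ with rfl | rfl
    · simp
    · have e : (a ∘ Equiv.swap 0 1 : Fin 2 → SVGen) = ![a 1, a 0] := by
        funext i; fin_cases i <;> rfl
      rw [e, h, ← ha]
      simp

lemma mem_SVCochain_one (f : SVRaw 1) : f ∈ SVCochain 1 := by
  intro σ a
  obtain rfl : σ = 1 := Subsingleton.elim _ _
  simp

lemma SVd_one_mem_SVcocycles (f : SVRaw 1) : SVd f ∈ SVcocycles 2 :=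
  ⟨(mem_SVCochain_two_iff _).2 (rename_swap_SVd_one f), SVd_SVd_one f⟩

section Euler

variable {σ τ : Type*} [Fintype σ]

/-- The chain rule for a derivation applied to a polynomial substitution. -/
lemma derivation_aeval {A : Type*} [CommRing A] [Algebra ℂ A] (d : Derivation ℂ A A)
    (v : σ → A) (p : MvPolynomial σ ℂ) :
    d (aeval v p) = ∑ i, aeval v (pderiv i p) * d (v i) := by
  classical
  induction p using MvPolynomial.induction_on with
  | C r => simp
  | add p q hp hq => simp [hp, hq, add_mul, Finset.sum_add_distrib]
  | mul_X p j h =>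
    have hs : ∑ i, aeval v (pderiv i (X j : MvPolynomial σ ℂ)) * d (v i) = d (v j) := by
      rw [Finset.sum_eq_single j] <;> simp +contextual [pderiv_X]
    rw [map_mul, aeval_X, Derivation.leibniz, h, ← hs]
    simp only [Derivation.leibniz, smul_eq_mul, map_add, map_mul, aeval_X, add_mul,
      Finset.sum_add_distrib, Finset.mul_sum, mul_assoc]

/-- The Euler derivation `∑ᵢ Xᵢ ∂/∂Xᵢ`. -/
noncomputable def euler (σ : Type*) :
    Derivation ℂ (MvPolynomial σ ℂ) (MvPolynomial σ ℂ) :=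
  mkDerivation ℂ X

lemma euler_X {σ : Type*} (i : σ) : euler σ (X i) = X i :=
  mkDerivation_X ℂ X i

lemma euler_apply (p : MvPolynomial σ ℂ) : euler σ p = ∑ i, X i * pderiv i p := by
  conv_lhs => rw [← aeval_X_left_apply p, derivation_aeval]
  simp only [aeval_X_left_apply, euler_X, mul_comm]

lemma euler_monomial (m : σ →₀ ℕ) (r : ℂ) :
    euler σ (monomial m r) = (m.degree : ℂ) • monomial m r := by
  simp only [euler_apply, X_mul_pderiv_monomial, ← Finset.sum_smul]
  rw [Finsupp.degree_eq_sum, ← Nat.cast_smul_eq_nsmul ℂ]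

lemma coeff_euler (p : MvPolynomial σ ℂ) (m : σ →₀ ℕ) :
    coeff m (euler σ p) = m.degree * coeff m p := by
  classical
  induction p using MvPolynomial.induction_on' with
  | monomial u r =>
    rw [euler_monomial, coeff_smul, coeff_monomial, smul_eq_mul]
    split_ifs with h
    · rw [h]
    · simp
  | add p q hp hq => simp [hp, hq, mul_add]

lemma euler_aeval (v : σ → MvPolynomial τ ℂ) (hv : ∀ i, euler τ (v i) = v i)
    (p : MvPolynomial σ ℂ) : euler τ (aeval v p) = aeval v (euler σ p) := by
  simp only [derivation_aeval, euler_apply p, hv, map_sum, map_mul, aeval_X, mul_comm]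

/-- Every polynomial is, modulo the image of `euler - w`, an eigenvector of `euler`. -/
lemma exists_euler_sub_smul (w : ℂ) (g : MvPolynomial σ ℂ) :
    ∃ f h, euler σ f - w • f = g - h ∧ euler σ h = w • h := by
  induction g using MvPolynomial.induction_on' with
  | monomial u r =>
    by_cases hw : (u.degree : ℂ) = w
    · exact ⟨0, monomial u r, by simp, by rw [euler_monomial, hw]⟩
    · refine ⟨monomial u (((u.degree : ℂ) - w)⁻¹ * r), 0, ?_, by simp⟩
      rw [euler_monomial, ← sub_smul, smul_monomial, smul_eq_mul,
        mul_inv_cancel_left₀ (sub_ne_zero.2 hw), sub_zero]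
  | add p q hp hq =>
    obtain ⟨f, h, e, e'⟩ := hp
    obtain ⟨f₂, h₂, e₂, e₂'⟩ := hq
    refine ⟨f + f₂, h + h₂, ?_, by simp [e', e₂']⟩
    rw [map_add, smul_add, add_sub_add_comm, e, e₂]
    ring

lemma euler_eq_smul_of_sub_eq {w : ℂ} {p q : MvPolynomial σ ℂ}
    (h : euler σ p - w • p = q) (hq : euler σ q = w • q) : euler σ p = w • p := by
  ext m
  have h1 := congrArg (coeff m) h
  have h2 := congrArg (coeff m) hq
  simp only [coeff_sub, coeff_smul, coeff_euler, smul_eq_mul] at h1 h2 ⊢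
  rw [← sub_eq_zero, ← sub_mul] at h2 ⊢
  rw [← sub_mul] at h1
  rw [← h1] at h2
  rcases mul_eq_zero.1 h2 with h | h
  · simp [h]
  · exact h

lemma isHomogeneous_of_euler {n : ℕ} {p : MvPolynomial σ ℂ} (h : euler σ p = (n : ℂ) • p) :
    p.IsHomogeneous n := by
  intro m hm
  have h1 := congrArg (coeff m) h
  simp only [coeff_smul, coeff_euler, smul_eq_mul] at h1
  have h2 := Finsupp.degree_eq_weight_one (R := ℕ) (σ := σ)
  exact (DFunLike.congr_fun h2 m).symm.trans (by exact_mod_cast mul_right_cancel₀ hm h1)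

lemma eq_zero_of_euler {w : ℂ} {p : MvPolynomial σ ℂ} (h : euler σ p = w • p)
    (hw : ∀ n : ℕ, (n : ℂ) ≠ w) : p = 0 := by
  ext m
  have h1 := congrArg (coeff m) h
  simp only [coeff_smul, coeff_euler, smul_eq_mul] at h1
  rw [coeff_zero]
  by_contra h0
  exact hw _ (mul_right_cancel₀ h0 h1)

end Euler

lemma exists_eq_C_of_isHomogeneous_zero {σ : Type*} {p : MvPolynomial σ ℂ} (h : p.IsHomogeneous 0) :
    ∃ r, p = C r :=
  ⟨_, totalDegree_eq_zero_iff_eq_C.1 ((totalDegree_zero_iff_isHomogeneous _).2 h)⟩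

lemma exists_eq_add_of_isHomogeneous_succ {n : ℕ} {p : MvPolynomial (Fin 2) ℂ}
    (h : p.IsHomogeneous (n + 1)) :
    ∃ q r : MvPolynomial (Fin 2) ℂ, q.IsHomogeneous n ∧ r.IsHomogeneous n ∧
      p = X 0 * q + X 1 * r := by
  refine ⟨C ((n : ℂ) + 1)⁻¹ * pderiv 0 p, C ((n : ℂ) + 1)⁻¹ * pderiv 1 p,
    h.pderiv.C_mul _, h.pderiv.C_mul _, ?_⟩
  have := h.sum_X_mul_pderiv
  rw [Fin.sum_univ_two, ← Nat.cast_smul_eq_nsmul ℂ, smul_eq_C_mul] at this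
  have h0 : (C ((n : ℂ) + 1)⁻¹ * C ((n : ℂ) + 1) : MvPolynomial (Fin 2) ℂ) = 1 := by
    rw [← C_mul, inv_mul_cancel₀ (by exact_mod_cast n.succ_ne_zero), C_1]
  push_cast at this
  linear_combination (-p) * h0 - C ((n : ℂ) + 1)⁻¹ * this

/-- The conformal weight of a generator, minus one. -/
noncomputable def weight : SVGen → ℂ
  | L => 1
  | Y => 1/2
  | M => 0

lemma SVbrk_L (a : SVGen) : SVbrk L a = (a, 1, weight a + 1) := by
  cases a <;> norm_num [SVbrk, weight]

lemma SVbrk_weight (a b : SVGen) :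
    ((SVbrk a b).2.1 = 0 ∧ (SVbrk a b).2.2 = 0) ∨
      weight a + weight b = weight (SVbrk a b).1 + 1 := by
  cases a <;> cases b <;> norm_num [SVbrk, weight]

lemma aeval_cons_swap {c : SVRaw 2} (hc : c ∈ SVCochain 2) {n : ℕ}
    (u v : MvPolynomial (Fin n) ℂ) (a b : SVGen) :
    aeval ![u, v] (c ![b, a]) = -aeval ![v, u] (c ![a, b]) := by
  rw [← map_neg, ← (mem_SVCochain_two_iff c).1 hc a b, aeval_rename]
  congr 2
  funext i
  fin_cases i <;> simp

/-- Differentiating the cocycle equation on `(L, a, b)` at `λ₁ = 0` expresses the Euler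
derivative of a `2`-cocycle through a coboundary. -/
lemma euler_cocycle {c : SVRaw 2} (hc : c ∈ SVcocycles 2) (a b : SVGen) :
    euler _ (c ![a, b]) - (weight a + weight b) • c ![a, b] =
      (C (SVbrk a b).2.2 * X 0 - C (SVbrk a b).2.1 * (X 0 + X 1)) *
        aeval ![X 0 + X 1] (aeval (![X 0, 0] : Fin 2 → MvPolynomial (Fin 1) ℂ)
          (pderiv 1 (c ![(SVbrk a b).1, L]))) := by
  have h : SVd c ![L, a, b] = 0 := congrFun hc.2 _
  rw [SVd_two_apply] at h
  change -((C (SVbrk L a).2.2 * X 0 - C (SVbrk L a).2.1 * (X 0 + X 1)) *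
        aeval ![X 0 + X 1, X 2] (c ![(SVbrk L a).1, b])) +
      (C (SVbrk L b).2.2 * X 0 - C (SVbrk L b).2.1 * (X 0 + X 2)) *
        aeval ![X 0 + X 2, X 1] (c ![(SVbrk L b).1, a]) -
      (C (SVbrk a b).2.2 * X 1 - C (SVbrk a b).2.1 * (X 1 + X 2)) *
        aeval ![X 1 + X 2, X 0] (c ![(SVbrk a b).1, L]) = 0 at h
  simp only [SVbrk_L] at h
  rw [aeval_cons_swap hc.1 _ _ a b] at h
  have h' := congrArg (fun p => aeval (![0, X 0, X 1] : Fin 3 → MvPolynomial (Fin 2) ℂ)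
    (pderiv 0 p)) h
  have e1 (p : MvPolynomial (Fin 2) ℂ) :
      aeval (![0, X 0, X 1] : Fin 3 → MvPolynomial (Fin 2) ℂ) (aeval (![X 0 + X 1, X 2] : Fin 2 → MvPolynomial (Fin 3) ℂ) p) =
        p := by
    rw [← AlgHom.comp_apply, comp_aeval]
    refine Eq.trans ?_ (aeval_X_left_apply p)
    congr 2
    funext i
    fin_cases i <;> simp
  have e2 (p : MvPolynomial (Fin 2) ℂ) :
      aeval (![0, X 0, X 1] : Fin 3 → MvPolynomial (Fin 2) ℂ) (aeval (![X 1, X 0 + X 2] : Fin 2 → MvPolynomial (Fin 3) ℂ) p) =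
        p := by
    rw [← AlgHom.comp_apply, comp_aeval]
    refine Eq.trans ?_ (aeval_X_left_apply p)
    congr 2
    funext i
    fin_cases i <;> simp
  have e3 (p : MvPolynomial (Fin 2) ℂ) :
      aeval (![0, X 0, X 1] : Fin 3 → MvPolynomial (Fin 2) ℂ) (aeval (![X 1 + X 2, X 0] : Fin 2 → MvPolynomial (Fin 3) ℂ) p) =
        aeval (![X 0 + X 1] : Fin 1 → MvPolynomial (Fin 2) ℂ)
          (aeval (![X 0, 0] : Fin 2 → MvPolynomial (Fin 1) ℂ) p) := by
    rw [← AlgHom.comp_apply, ← AlgHom.comp_apply, comp_aeval, comp_aeval]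
    congr 2
    funext i
    fin_cases i <;> simp
  simp [derivation_aeval, Fin.sum_univ_two, pderiv_X, e1, e2, e3, -aeval_eq_bind₁] at h'
  rw [euler_apply, Fin.sum_univ_two, smul_eq_C_mul, C_add]
  linear_combination h'

/-- Every `2`-cocycle is cohomologous to one that is homogeneous of the total weight. -/
lemma exists_euler_add_SVd {c : SVRaw 2} (hc : c ∈ SVcocycles 2) :
    ∃ f : SVRaw 1, ∀ a b, euler _ ((c + SVd f) ![a, b]) =
      (weight a + weight b) • (c + SVd f) ![a, b] := by
  choose f h hf hh using fun a => exists_euler_sub_smul (weight a)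
    (aeval (![X 0, 0] : Fin 2 → MvPolynomial (Fin 1) ℂ) (pderiv 1 (c ![a, L])))
  refine ⟨fun t => f (t 0), fun a b => ?_⟩
  have hc' := euler_cocycle hc a b
  rw [Pi.add_apply, SVd_one_apply]
  simp only [Matrix.cons_val_zero, Matrix.cons_val_one, Matrix.cons_val_fin_one]
  rcases SVbrk_weight a b with hk | hw
  · rw [hk.1, hk.2] at hc' ⊢
    simpa [sub_eq_zero] using hc'
  · rw [hw] at hc' ⊢
    generalize (SVbrk a b).1 = x at *
    set k : MvPolynomial (Fin 2) ℂ :=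
      C (SVbrk a b).2.2 * X 0 - C (SVbrk a b).2.1 * (X 0 + X 1) with hk
    have hek : euler _ k = k := by
      simp [hk, euler_X, ← algebraMap_eq]
    have he (p : MvPolynomial (Fin 1) ℂ) :
        euler _ (aeval (![X 0 + X 1] : Fin 1 → MvPolynomial (Fin 2) ℂ) p) =
          aeval ![X 0 + X 1] (euler _ p) :=
      euler_aeval _ (fun i => by fin_cases i; simp [euler_X]) p
    have hfx := congrArg (aeval (![X 0 + X 1] : Fin 1 → MvPolynomial (Fin 2) ℂ)) (hf x)
    have hhx := congrArg (aeval (![X 0 + X 1] : Fin 1 → MvPolynomial (Fin 2) ℂ)) (hh x)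
    simp only [map_sub, map_smul, ← he] at hfx hhx
    apply euler_eq_smul_of_sub_eq
      (q := k * aeval (![X 0 + X 1] : Fin 1 → MvPolynomial (Fin 2) ℂ) (h x))
    · simp only [map_add, map_neg, Derivation.leibniz, smul_eq_mul, hek, smul_eq_C_mul, C_1]
        at hc' hfx ⊢
      linear_combination hc' - k * hfx
    · simp only [Derivation.leibniz, smul_eq_mul, hek, hhx, smul_eq_C_mul, C_1, map_add]
      ring

/-- A `2`-cocycle that is homogeneous of the total weight is a coboundary. -/
lemma exists_SVd_eq_of_euler {c : SVRaw 2} (hc : c ∈ SVcocycles 2)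
    (he : ∀ a b, euler _ (c ![a, b]) = (weight a + weight b) • c ![a, b]) :
    ∃ f : SVRaw 1, c = SVd f := by
  have half (n : ℕ) : (n : ℂ) ≠ 1 / 2 := by
    intro h
    have : ((2 * n : ℕ) : ℂ) = (1 : ℕ) := by push_cast; rw [h]; norm_num
    have := Nat.cast_injective this
    omega
  have three_half (n : ℕ) : (n : ℂ) ≠ 3 / 2 := by
    intro h
    have : ((2 * n : ℕ) : ℂ) = (3 : ℕ) := by push_cast; rw [h]; norm_num
    have := Nat.cast_injective this
    omega
  have sk := (mem_SVCochain_two_iff c).1 hc.1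
  have sk' (a b : SVGen) : c ![b, a] = -rename (Equiv.swap 0 1) (c ![a, b]) := by
    rw [sk, neg_neg]
  have hLY : c ![L, Y] = 0 := eq_zero_of_euler (he L Y) (by norm_num [weight]; exact three_half)
  have hYM : c ![Y, M] = 0 := eq_zero_of_euler (he Y M) (by norm_num [weight]; simpa using half)
  have hMM : c ![M, M] = 0 := by
    obtain ⟨r, hr⟩ := exists_eq_C_of_isHomogeneous_zero (isHomogeneous_of_euler (n := 0)
      (by simpa [weight] using he M M))
    have := sk M M
    rw [hr, rename_C, ← C_neg, C_inj, self_eq_neg] at this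
    rw [hr, this, C_0]
  have linear {p : MvPolynomial (Fin 2) ℂ} (hp : p.IsHomogeneous 1) :
      ∃ r s : ℂ, p = C r * X 0 + C s * X 1 := by
    obtain ⟨q, q', hq, hq', rfl⟩ := exists_eq_add_of_isHomogeneous_succ hp
    obtain ⟨r, rfl⟩ := exists_eq_C_of_isHomogeneous_zero hq
    obtain ⟨s, rfl⟩ := exists_eq_C_of_isHomogeneous_zero hq'
    exact ⟨r, s, by ring⟩
  obtain ⟨α, hLL⟩ : ∃ α, c ![L, L] = C α * (X 0 ^ 2 - X 1 ^ 2) := by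
    obtain ⟨q, q', hq, hq', h⟩ := exists_eq_add_of_isHomogeneous_succ (isHomogeneous_of_euler (n := 2)
      (by have := he L L; norm_num [weight] at this; exact_mod_cast this))
    obtain ⟨r, s, rfl⟩ := linear hq
    obtain ⟨r', s', rfl⟩ := linear hq'
    have h1 := sk L L
    rw [h] at h1
    have h2 := congrArg (eval ![1, 0]) h1
    have h3 := congrArg (eval ![1, 1]) h1
    simp at h2 h3
    have h4 : s = -r' := by linear_combination h3 / 2 - h2
    refine ⟨r, ?_⟩
    rw [h, h2, h4]
    simp only [C_neg]
    ring
  obtain ⟨β, hYY⟩ : ∃ β, c ![Y, Y] = C β * (X 0 - X 1) := by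
    obtain ⟨r, s, h⟩ := linear (isHomogeneous_of_euler (n := 1)
      (by have := he Y Y; norm_num [weight] at this; simpa using this))
    have h1 := sk Y Y
    rw [h] at h1
    have h2 := congrArg (eval ![1, 0]) h1
    simp at h2
    refine ⟨r, ?_⟩
    rw [h, h2]
    simp only [C_neg]
    ring
  obtain ⟨r, μ, hLM⟩ : ∃ r μ, c ![L, M] = C r * X 0 + C μ * X 1 :=
    linear (isHomogeneous_of_euler (n := 1)
      (by have := he L M; norm_num [weight] at this; simpa using this))
  have hML := sk' L M
  have hMY := sk' Y M
  have hYL := sk' L Y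
  simp only [hLM, hYM, hLY, map_add, map_mul, rename_C, rename_X, Equiv.swap_apply_left,
    Equiv.swap_apply_right, map_zero, neg_zero] at hML hMY hYL
  have hr : r = 0 := by
    have h : SVd c ![L, L, M] = 0 := congrFun hc.2 _
    rw [SVd_two_apply] at h
    have h := congrArg (eval ![1, 0, 0]) h
    simp [SVbrk, hLM, hML] at h
    norm_num at h
    exact h
  have hβ : β = -μ := by
    have h : SVd c ![L, Y, Y] = 0 := congrFun hc.2 _
    rw [SVd_two_apply] at h
    have h := congrArg (eval ![0, 1, 0]) h
    simp [SVbrk, hYY, hML, hr] at h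
    linear_combination h
  subst hr hβ
  refine ⟨fun t => match t 0 with
    | L => C (-α) * X 0
    | Y => 0
    | M => C μ, ?_⟩
  funext t
  obtain ⟨a, b, rfl⟩ : ∃ a b, t = ![a, b] :=
    ⟨t 0, t 1, by funext i; fin_cases i <;> rfl⟩
  rw [SVd_one_apply]
  apply MvPolynomial.funext
  intro x
  cases a <;> cases b <;>
    simp [SVbrk, hLL, hLY, hLM, hYL, hYY, hYM, hML, hMY, hMM] <;> ring

/-- `H̃²(SV,ℂ) = 0`: every `2`-cocycle is a `2`-coboundary. -/
theorem statement6 :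
    SVcocycles 2 ≤ SVcoboundaries 2 ∧ Subsingleton (SVbasicH 2) := by
  have h : SVcocycles 2 ≤ SVcoboundaries 2 := by
    intro c hc
    obtain ⟨f, hf⟩ := exists_euler_add_SVd hc
    obtain ⟨f', hf'⟩ := exists_SVd_eq_of_euler
      (add_mem hc (SVd_one_mem_SVcocycles f)) hf
    refine ⟨f' - f, mem_SVCochain_one _, ?_⟩
    rw [map_sub]
    exact sub_eq_of_eq_add hf'.symm
  refine ⟨h, ?_⟩
  unfold SVbasicH
  rw [Submodule.Quotient.subsingleton_iff, Submodule.comap_subtype_eq_top]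
  exact h

end SVCA
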